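/- arXiv:1507.01115 — 8 statements merged into one kernel-verified Lean document; each statement's English description precedes it below -/
import Mathlib

section
/- Let G = (g_{jk}) be a symmetric n×n matrix of entire functions on ℂⁿ whose determinant never vanishes, with inverse matrix (g^{jk}). Let f and α be nowhere-vanishing entire functions on ℂⁿ. Write z^k = x^k + i·x^{n+k}, and define real 2n×2n matrices H = (H^{ab}) and K = (K^{ab}) by H^{ij} = Re g^{ij}, H^{i,n+j} = H^{n+i,j} = Im g^{ij}, H^{n+i,n+j} = −Re g^{ij}, and K^{ij} = Im g^{ij}, K^{i,n+j} = K^{n+i,j} = −Re g^{ij}, K^{n+i,n+j} = −Im g^{ij} (these are the contravariant components of the anti-Kählerian metric h and its twin metric k associated with the holomorphic metric g). For a smooth real function u on ℂⁿ ≅ ℝ^{2n}, set grad_h u = (Σ_a H^{ab} ∂u/∂x^a)_b and grad_k u = (Σ_a K^{ab} ∂u/∂x^a)_b. Then α is a holomorphic last multiplier for the holomorphic gradient vector field grad_g(log f) := ((1/f)·Σ_i g^{ij} ∂f/∂z^i)_j if and only if |α|² is a real last multiplier (with respect to Lebesgue volume) for BOTH real vector fields (1/|f|²)·grad_h(|f|²)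 and (1/|f|²)·grad_k(|f|²). -/
open scoped BigOperators

variable {n : ℕ}

/-- Partial derivative ∂f/∂z^i of a function on ℂⁿ. -/
noncomputable def pd (f : (Fin n → ℂ) → ℂ) (i : Fin n) (z : Fin n → ℂ) : ℂ :=
  fderiv ℂ f z (Pi.single i 1)

/-- Holomorphic divergence div Z = Σ_k ∂Z^k/∂z^k. -/
noncomputable def hdiv (Z : (Fin n → ℂ) → (Fin n → ℂ)) (z : Fin n → ℂ) : ℂ :=
  ∑ k, pd (fun w => Z w k) k z

/-- Holomorphic last multiplier: Z(α) + α · div Z = 0. -/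
def IsHLM (Z : (Fin n → ℂ) → (Fin n → ℂ)) (α : (Fin n → ℂ) → ℂ) : Prop :=
  ∀ z, (∑ k, Z z k * pd α k z) + α z * hdiv Z z = 0

/-- Real divergence: trace over ℝ of the real Fréchet derivative. -/
noncomputable def rdiv (X : (Fin n → ℂ) → (Fin n → ℂ)) (z : Fin n → ℂ) : ℝ :=
  LinearMap.trace ℝ (Fin n → ℂ) (fderiv ℝ X z : (Fin n → ℂ) →ₗ[ℝ] (Fin n → ℂ))

/-- Real last multiplier: (Dᵣu)(X) + u · divᵣ X = 0. -/
def IsRLM (X : (Fin n → ℂ) → (Fin n → ℂ)) (u : (Fin n → ℂ) → ℝ) : Prop :=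
  ∀ z, fderiv ℝ u z (X z) + u z * rdiv X z = 0

/-- ∂u/∂x^i for real-valued u. -/
noncomputable def px (u : (Fin n → ℂ) → ℝ) (i : Fin n) (z : Fin n → ℂ) : ℝ :=
  fderiv ℝ u z (Pi.single i 1)

/-- ∂u/∂x^{n+i} for real-valued u. -/
noncomputable def py (u : (Fin n → ℂ) → ℝ) (i : Fin n) (z : Fin n → ℂ) : ℝ :=
  fderiv ℝ u z (Pi.single i Complex.I)

/-- Lie bracket of two vector fields. -/
noncomputable def lie (Z W : (Fin n → ℂ) → (Fin n → ℂ)) (z : Fin n → ℂ) : Fin n → ℂ :=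
  fderiv ℂ W z (Z z) - fderiv ℂ Z z (W z)

/-- Holomorphic Laplacian Δu = Σ_i ∂²u/∂(z^i)². -/
noncomputable def lap (f : (Fin n → ℂ) → ℂ) (z : Fin n → ℂ) : ℂ :=
  ∑ i, pd (pd f i) i z

/-- The real trace of a complex-linear endomorphism of `ℂⁿ` is twice the real part of its
complex trace. -/
lemma trace_restrictScalars_eq (L : (Fin n → ℂ) →L[ℂ] (Fin n → ℂ)) :
    LinearMap.trace ℝ (Fin n → ℂ)
        ((L.restrictScalars ℝ : (Fin n → ℂ) →L[ℝ] (Fin n → ℂ)) : (Fin n → ℂ) →ₗ[ℝ] (Fin n → ℂ)) =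
      2 * (∑ k, L (Pi.single k 1) k).re := by
  have hI : ∀ k : Fin n, L (Pi.single k Complex.I) = Complex.I • L (Pi.single k 1) := by
    intro k
    rw [← map_smul, ← Pi.single_smul, smul_eq_mul, mul_one]
  rw [LinearMap.trace_eq_matrix_trace ℝ (Pi.basis fun _ : Fin n => Complex.basisOneI),
    Matrix.trace, Fintype.sum_sigma, Complex.re_sum, Finset.mul_sum]
  refine Finset.sum_congr rfl fun k _ => ?_
  simp [LinearMap.toMatrix_apply, Pi.basis_repr, Fin.sum_univ_two, hI, two_mul]

lemma rdiv_eq_two_mul_re_hdiv {Z : (Fin n → ℂ) → (Fin n → ℂ)} {z : Fin n → ℂ}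
    (hZ : DifferentiableAt ℂ Z z) : rdiv Z z = 2 * (hdiv Z z).re := by
  rw [rdiv, hZ.fderiv_restrictScalars ℝ, trace_restrictScalars_eq, hdiv]
  congr 2
  refine Finset.sum_congr rfl fun k _ => ?_
  rw [pd, fderiv_pi (differentiableAt_pi.1 hZ)]
  rfl

lemma fderiv_normSq_comp {f : (Fin n → ℂ) → ℂ} {z : Fin n → ℂ}
    (hf : DifferentiableAt ℂ f z) (v : Fin n → ℂ) :
    fderiv ℝ (fun w => Complex.normSq (f w)) z v =
      2 * ((starRingEnd ℂ) (f z) * fderiv ℂ f z v).re := by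
  have h := (hf.hasFDerivAt.restrictScalars ℝ)
  have hre := Complex.reCLM.hasFDerivAt.comp z h
  have him := Complex.imCLM.hasFDerivAt.comp z h
  have hs := (hre.mul hre).add (him.mul him)
  have he : (fun w => Complex.normSq (f w)) =
      fun w => (f w).re * (f w).re + (f w).im * (f w).im := by
    ext w; exact Complex.normSq_apply _
  rw [he]
  erw [hs.fderiv]
  simp
  ring

lemma fderiv_apply_eq_sum_pd (f : (Fin n → ℂ) → ℂ) (z v : Fin n → ℂ) :
    fderiv ℂ f z v = ∑ k, v k * pd f k z := by
  conv_lhs => rw [pi_eq_sum_univ' v]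
  simp [pd, map_sum]

lemma hdiv_const_smul {Z : (Fin n → ℂ) → (Fin n → ℂ)} {z : Fin n → ℂ}
    (hZ : DifferentiableAt ℂ Z z) (c : ℂ) : hdiv (c • Z) z = c * hdiv Z z := by
  rw [hdiv, hdiv, Finset.mul_sum]
  refine Finset.sum_congr rfl fun k _ => ?_
  simp only [pd, Pi.smul_apply]
  rw [fderiv_fun_const_smul (differentiableAt_pi.1 hZ k)]
  rfl

/-- For a holomorphic field `Z`, `|α|²` is a real last multiplier of `c Z` exactly when
`Re (c ᾱ (Z(α) + α div Z))` vanishes. -/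
lemma isRLM_const_smul_iff {Z : (Fin n → ℂ) → (Fin n → ℂ)} {α : (Fin n → ℂ) → ℂ}
    (hZ : Differentiable ℂ Z) (hα : Differentiable ℂ α) (c : ℂ) :
    IsRLM (c • Z) (fun z => Complex.normSq (α z)) ↔
      ∀ z, (c * ((starRingEnd ℂ) (α z) *
        ((∑ k, Z z k * pd α k z) + α z * hdiv Z z))).re = 0 := by
  refine forall_congr' fun z => ?_
  rw [fderiv_normSq_comp (hα z), rdiv_eq_two_mul_re_hdiv ((hZ z).const_smul c),
    hdiv_const_smul (hZ z), Pi.smul_apply, map_smul, fderiv_apply_eq_sum_pd, smul_eq_mul]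
  generalize (∑ k, Z z k * pd α k z) = s
  have key : 2 * ((starRingEnd ℂ) (α z) * (c * s)).re +
      Complex.normSq (α z) * (2 * (c * hdiv Z z).re) =
      2 * (c * ((starRingEnd ℂ) (α z) * (s + α z * hdiv Z z))).re := by
    simp only [Complex.normSq_apply, Complex.mul_re, Complex.mul_im, Complex.add_re,
      Complex.add_im, Complex.conj_re, Complex.conj_im]
    ring
  rw [key, mul_eq_zero, or_iff_right two_ne_zero]

lemma isHLM_iff_isRLM_normSq {Z : (Fin n → ℂ) → (Fin n → ℂ)} {α : (Fin n → ℂ) → ℂ}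
    (hZ : Differentiable ℂ Z) (hα : Differentiable ℂ α) (hα0 : ∀ z, α z ≠ 0) :
    IsHLM Z α ↔ IsRLM ((2 : ℂ) • Z) (fun z => Complex.normSq (α z)) ∧
      IsRLM ((-2 * Complex.I) • Z) (fun z => Complex.normSq (α z)) := by
  rw [isRLM_const_smul_iff hZ hα, isRLM_const_smul_iff hZ hα, ← forall_and]
  refine forall_congr' fun z => ?_
  have hc : (starRingEnd ℂ) (α z) ≠ 0 := (map_ne_zero _).2 (hα0 z)
  rw [← mul_eq_zero_iff_left hc, Complex.ext_iff]
  simp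

lemma differentiable_matrix_det {m : ℕ} {E : Type*} [NormedAddCommGroup E] [NormedSpace ℂ E]
    {A : E → Matrix (Fin m) (Fin m) ℂ} (hA : ∀ i j, Differentiable ℂ fun w => A w i j) :
    Differentiable ℂ fun w => (A w).det := by
  simp only [Matrix.det_apply']
  fun_prop

lemma differentiable_matrix_inv_apply {m : ℕ} {E : Type*} [NormedAddCommGroup E]
    [NormedSpace ℂ E] {A : E → Matrix (Fin m) (Fin m) ℂ}
    (hA : ∀ i j, Differentiable ℂ fun w => A w i j) (hdet : ∀ w, (A w).det ≠ 0) (i j : Fin m) :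
    Differentiable ℂ fun w => (A w)⁻¹ i j := by
  simp only [Matrix.inv_def, Matrix.smul_apply, Ring.inverse_eq_inv', smul_eq_mul,
    Matrix.adjugate_apply]
  refine ((differentiable_matrix_det hA).inv hdet).mul (differentiable_matrix_det fun k l => ?_)
  simp only [Matrix.updateRow_apply]
  split_ifs
  · exact differentiable_const _
  · exact hA k l

lemma px_normSq {f : (Fin n → ℂ) → ℂ} {z : Fin n → ℂ} (hf : DifferentiableAt ℂ f z) (i : Fin n) :
    px (fun w => Complex.normSq (f w)) i z = 2 * ((starRingEnd ℂ) (f z) * pd f i z).re :=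
  fderiv_normSq_comp hf _

lemma py_normSq {f : (Fin n → ℂ) → ℂ} {z : Fin n → ℂ} (hf : DifferentiableAt ℂ f z) (i : Fin n) :
    py (fun w => Complex.normSq (f w)) i z = -2 * ((starRingEnd ℂ) (f z) * pd f i z).im := by
  have hI : (Pi.single i Complex.I : Fin n → ℂ) = Complex.I • Pi.single i 1 := by
    rw [← Pi.single_smul, smul_eq_mul, mul_one]
  rw [py, fderiv_normSq_comp hf, hI, map_smul, smul_eq_mul, ← pd, mul_left_comm,
    Complex.I_mul_re]
  ring

/-- Real components `r`, `s` with `r + i s = c g ā p` sum, after division by `|a|²`, to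
`(c / a) Σ g p`. -/
lemma inv_normSq_mul_sum {a c : ℂ} (ha : a ≠ 0) (g p : Fin n → ℂ) (r s : Fin n → ℝ)
    (h : ∀ i, (r i : ℂ) + Complex.I * s i = c * (g i * ((starRingEnd ℂ) a * p i))) :
    ((Complex.normSq a : ℂ))⁻¹ * (Complex.ofReal (∑ i, r i) +
      Complex.I * Complex.ofReal (∑ i, s i)) = c * (a⁻¹ * ∑ i, g i * p i) := by
  have hc : (starRingEnd ℂ) a ≠ 0 := (map_ne_zero _).2 ha
  have hsum : Complex.ofReal (∑ i, r i) + Complex.I * Complex.ofReal (∑ i, s i) =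
      c * ((starRingEnd ℂ) a * ∑ i, g i * p i) := by
    rw [Complex.ofReal_sum, Complex.ofReal_sum, Finset.mul_sum, ← Finset.sum_add_distrib,
      Finset.mul_sum, Finset.mul_sum]
    refine Finset.sum_congr rfl fun i _ => ?_
    rw [h]
    ring
  rw [hsum, ← Complex.mul_conj]
  field_simp

/-- For a holomorphic Riemannian metric g on ℂⁿ (symmetric entire matrix G
with nowhere-vanishing determinant and inverse matrix Ginv) and nowhere-vanishing entire f, α:
α is a holomorphic last multiplier for grad_g(log f) = ((1/f)Σ_i g^{ij}∂f/∂z^i)_j iff |α|² is a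
real last multiplier for both (1/|f|²)·grad_h(|f|²) and (1/|f|²)·grad_k(|f|²), where h, k are
the associated anti-Kählerian metric and its twin (contravariant components H, K built from
Re g^{ij}, Im g^{ij} as in the statement, and real coordinates z^k = x^k + i x^{n+k}). -/
theorem last_multiplier_gradient_iff_anti_Kahler
    (G Ginv : (Fin n → ℂ) → Matrix (Fin n) (Fin n) ℂ)
    (hG : ∀ i j z, AnalyticAt ℂ (fun w => G w i j) z)
    (hGsymm : ∀ z i j, G z i j = G z j i)
    (hGdet : ∀ z, (G z).det ≠ 0)
    (hGinv : ∀ z, G z * Ginv z = 1)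
    (f α : (Fin n → ℂ) → ℂ)
    (hf : ∀ z, AnalyticAt ℂ f z) (hf0 : ∀ z, f z ≠ 0)
    (hα : ∀ z, AnalyticAt ℂ α z) (hα0 : ∀ z, α z ≠ 0) :
    IsHLM (fun z j => (f z)⁻¹ * ∑ i, Ginv z i j * pd f i z) α ↔
      (IsRLM (fun z j => ((Complex.normSq (f z) : ℂ))⁻¹ *
          ((Complex.ofReal (∑ i,
              ((Ginv z i j).re * px (fun w => Complex.normSq (f w)) i z +
               (Ginv z i j).im * py (fun w => Complex.normSq (f w)) i z))) +
           Complex.I * Complex.ofReal (∑ i,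
              ((Ginv z i j).im * px (fun w => Complex.normSq (f w)) i z -
               (Ginv z i j).re * py (fun w => Complex.normSq (f w)) i z))))
        (fun z => Complex.normSq (α z)) ∧
       IsRLM (fun z j => ((Complex.normSq (f z) : ℂ))⁻¹ *
          ((Complex.ofReal (∑ i,
              ((Ginv z i j).im * px (fun w => Complex.normSq (f w)) i z -
               (Ginv z i j).re * py (fun w => Complex.normSq (f w)) i z))) +
           Complex.I * Complex.ofReal (∑ i,
              (-(Ginv z i j).re * px (fun w => Complex.normSq (f w)) i z -
               (Ginv z i j).im * py (fun w => Complex.normSq (f w)) i z))))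
        (fun z => Complex.normSq (α z))) := by
  have hf' : Differentiable ℂ f := fun z => (hf z).differentiableAt
  have hα' : Differentiable ℂ α := fun z => (hα z).differentiableAt
  have hinv : ∀ i j, Differentiable ℂ fun w => Ginv w i j := by
    intro i j
    have he : Ginv = fun w => (G w)⁻¹ :=
      funext fun w => (Matrix.inv_eq_right_inv (hGinv w)).symm
    rw [he]
    exact differentiable_matrix_inv_apply (fun k l z => (hG k l z).differentiableAt) hGdet i j
  have hpd : ∀ i, Differentiable ℂ (pd f i) := fun i z =>
    (hf z).fderiv.differentiableAt.clm_apply (differentiableAt_const _)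
  have hZ : Differentiable ℂ
      (fun (z : Fin n → ℂ) (j : Fin n) => (f z)⁻¹ * ∑ i, Ginv z i j * pd f i z) :=
    differentiable_pi.2 fun j =>
      (hf'.inv hf0).mul (Differentiable.fun_sum fun i _ => (hinv i j).mul (hpd i))
  rw [isHLM_iff_isRLM_normSq hZ hα' hα0]
  refine iff_of_eq (congrArg₂ And (congrArg (IsRLM · _) ?_) (congrArg (IsRLM · _) ?_))
  all_goals
    funext z j
    refine (inv_normSq_mul_sum (hf0 z) (fun i => Ginv z i j) (fun i => pd f i z) _ _
      fun i => ?_).symm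
    rw [px_normSq (hf' z), py_normSq (hf' z)]
    generalize (starRingEnd ℂ) (f z) * pd f i z = w
    apply Complex.ext <;> simp <;> ring
end

section
/- Let P = (P^{ij}) be an antisymmetric 4×4 matrix of entire functions on ℂ⁴ such that P(z₀) = 0 at some point z₀ ∈ ℂ⁴. Then the following are equivalent: (i) P is an exact holomorphic Poisson bivector, i.e. P satisfies the Jacobi identity Σ_{l=1}^4 (P^{li} ∂P^{jk}/∂z^l + P^{lj} ∂P^{ki}/∂z^l + P^{lk} ∂P^{ij}/∂z^l) = 0 for all i,j,k, and Σ_{j=1}^4 ∂P^{ij}/∂z^j = 0 for all i; (ii) the Pfaffian P^{12}P^{34} − P^{13}P^{24} + P^{14}P^{23} vanishes identically on ℂ⁴ (equivalently ι_P ω₀ ∧ ι_P ω₀ = 0) and Σ_{j=1}^4 ∂P^{ij}/∂z^j = 0 for all i (equivalently ∂(ι_P ω₀) = 0). -/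
open scoped BigOperators

variable {n : ℕ}

/-- The quadratic expression `A l i A j k + A l j A k i + A l k A i j`, the components of `A ∧ A`. -/
def wedgeSq (A : Matrix (Fin n) (Fin n) ℂ) (l i j k : Fin n) : ℂ :=
  A l i * A j k + A l j * A k i + A l k * A i j

theorem pd_wedgeSq {P : (Fin n → ℂ) → Matrix (Fin n) (Fin n) ℂ}
    (hP : ∀ i j z, DifferentiableAt ℂ (fun w => P w i j) z) (l i j k m : Fin n) (z : Fin n → ℂ) :
    pd (fun w => wedgeSq (P w) l i j k) m z =
      P z l i * pd (fun w => P w j k) m z + P z j k * pd (fun w => P w l i) m z +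
      (P z l j * pd (fun w => P w k i) m z + P z k i * pd (fun w => P w l j) m z) +
      (P z l k * pd (fun w => P w i j) m z + P z i j * pd (fun w => P w l k) m z) := by
  have h := ((((hP l i z).hasFDerivAt.mul (hP j k z).hasFDerivAt).add
    ((hP l j z).hasFDerivAt.mul (hP k i z).hasFDerivAt)).add
    ((hP l k z).hasFDerivAt.mul (hP i j z).hasFDerivAt)).fderiv
  exact DFunLike.congr_fun h (Pi.single m 1)

/-- For a divergence-free antisymmetric `P`, the Jacobiator is the divergence of `P ∧ P`. -/
theorem jacobiator_eq_sum_pd_wedgeSq {P : (Fin n → ℂ) → Matrix (Fin n) (Fin n) ℂ}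
    (hP : ∀ i j z, DifferentiableAt ℂ (fun w => P w i j) z)
    (hPanti : ∀ z i j, P z i j = -P z j i)
    (hdivP : ∀ i z, ∑ j, pd (fun w => P w i j) j z = 0) (z : Fin n → ℂ) (i j k : Fin n) :
    ∑ l, (P z l i * pd (fun w => P w j k) l z + P z l j * pd (fun w => P w k i) l z +
      P z l k * pd (fun w => P w i j) l z) = ∑ l, pd (fun w => wedgeSq (P w) l i j k) l z := by
  have hdiv' (a : Fin n) : ∑ l, pd (fun w => P w l a) l z = 0 := by
    have h (l : Fin n) : pd (fun w => P w l a) l z = -pd (fun w => P w a l) l z := by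
      simp only [pd, fun w => hPanti w l a, fderiv_fun_neg, neg_apply]
    simp only [h, Finset.sum_neg_distrib, hdivP, neg_zero]
  simp only [pd_wedgeSq hP, Finset.sum_add_distrib, ← Finset.mul_sum, hdiv', mul_zero, add_zero]

/-- The Pfaffian of an antisymmetric 4×4 matrix. -/
def pfaffianFour (A : Matrix (Fin 4) (Fin 4) ℂ) : ℂ :=
  A 0 1 * A 2 3 - A 0 2 * A 1 3 + A 0 3 * A 1 2

theorem wedgeSq_rotate (A : Matrix (Fin n) (Fin n) ℂ) (l i j k : Fin n) :
    wedgeSq A l i j k = wedgeSq A l j k i := by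
  simp only [wedgeSq]; ring

theorem wedgeSq_self_left {A : Matrix (Fin n) (Fin n) ℂ} (hA : ∀ i j, A i j = -A j i) (i j k : Fin n) :
    wedgeSq A i i j k = 0 := by
  have h : A i i = 0 := self_eq_neg.mp (hA i i)
  simp only [wedgeSq, h, hA k i]; ring

theorem wedgeSq_eq_zero_of_pfaffianFour {A : Matrix (Fin 4) (Fin 4) ℂ}
    (hA : ∀ i j, A i j = -A j i) (hpf : pfaffianFour A = 0) (l i j k : Fin 4) :
    wedgeSq A l i j k = 0 := by
  have hd (i : Fin 4) : A i i = 0 := self_eq_neg.mp (hA i i)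
  simp only [pfaffianFour] at hpf
  fin_cases l <;> fin_cases i <;> fin_cases j <;> fin_cases k <;>
    simp only [wedgeSq, Fin.zero_eta, Fin.mk_one, Fin.reduceFinMk, hd, hA 1 0, hA 2 0, hA 3 0,
      hA 2 1, hA 3 1, hA 3 2] <;>
    first | ring1 | linear_combination hpf | linear_combination -hpf

theorem differentiable_pfaffianFour {P : (Fin 4 → ℂ) → Matrix (Fin 4) (Fin 4) ℂ}
    (hP : ∀ i j z, DifferentiableAt ℂ (fun w => P w i j) z) :
    Differentiable ℂ fun w => pfaffianFour (P w) := fun z =>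
  (((hP 0 1 z).mul (hP 2 3 z)).sub ((hP 0 2 z).mul (hP 1 3 z))).add ((hP 0 3 z).mul (hP 1 2 z))

/-- If `P ∧ P` is divergence-free, then the Pfaffian has vanishing partial derivatives. -/
theorem pd_pfaffianFour_eq_zero {P : (Fin 4 → ℂ) → Matrix (Fin 4) (Fin 4) ℂ}
    (hPanti : ∀ z i j, P z i j = -P z j i)
    (h : ∀ z i j k, ∑ l, pd (fun w => wedgeSq (P w) l i j k) l z = 0)
    (m : Fin 4) (z : Fin 4 → ℂ) : pd (fun w => pfaffianFour (P w)) m z = 0 := by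
  have hrow (i j k : Fin 4) (hi : m ≠ i) (hj : m ≠ j) (hk : m ≠ k) (hij : i ≠ j) (hjk : j ≠ k)
      (hik : i ≠ k) : pd (fun w => wedgeSq (P w) m i j k) m z = 0 := by
    rw [← h z i j k, eq_comm]
    refine Finset.sum_eq_single m (fun l _ hl => ?_) (by simp)
    have hl' : l = i ∨ l = j ∨ l = k := by lia
    have hz (w : Fin 4 → ℂ) : wedgeSq (P w) l i j k = 0 := by
      rcases hl' with rfl | rfl | rfl
      · exact wedgeSq_self_left (hPanti w) _ _ _
      · rw [wedgeSq_rotate, wedgeSq_self_left (hPanti w)]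
      · rw [wedgeSq_rotate, wedgeSq_rotate, wedgeSq_self_left (hPanti w)]
    simp [hz, pd]
  have key (i j k : Fin 4) (hi : m ≠ i) (hj : m ≠ j) (hk : m ≠ k) (hij : i ≠ j) (hjk : j ≠ k)
      (hik : i ≠ k) (hQ : ∀ w, pfaffianFour (P w) = wedgeSq (P w) m i j k) :
      pd (fun w => pfaffianFour (P w)) m z = 0 := by
    simpa only [hQ] using hrow i j k hi hj hk hij hjk hik
  fin_cases m
  · refine key 1 2 3 (by decide) (by decide) (by decide) (by decide) (by decide) (by decide)
      fun w => ?_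
    simp only [pfaffianFour, wedgeSq, Fin.zero_eta, hPanti w 3 1]; ring
  · refine key 0 3 2 (by decide) (by decide) (by decide) (by decide) (by decide) (by decide)
      fun w => ?_
    simp only [pfaffianFour, wedgeSq, Fin.mk_one, hPanti w 1 0, hPanti w 3 2, hPanti w 2 0]; ring
  · refine key 0 1 3 (by decide) (by decide) (by decide) (by decide) (by decide) (by decide)
      fun w => ?_
    simp only [pfaffianFour, wedgeSq, Fin.reduceFinMk, hPanti w 2 0, hPanti w 2 1, hPanti w 3 0]
    ring
  · refine key 0 2 1 (by decide) (by decide) (by decide) (by decide) (by decide) (by decide)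
      fun w => ?_
    simp only [pfaffianFour, wedgeSq, Fin.reduceFinMk, hPanti w 3 0, hPanti w 3 1, hPanti w 3 2,
      hPanti w 1 0, hPanti w 2 1]
    ring

theorem eq_of_pd_eq_zero {f : (Fin n → ℂ) → ℂ} (hf : Differentiable ℂ f)
    (h : ∀ m z, pd f m z = 0) (x y : Fin n → ℂ) : f x = f y := by
  refine is_const_of_fderiv_eq_zero hf (fun z => ?_) x y
  refine ContinuousLinearMap.coe_injective (LinearMap.pi_ext' fun m => LinearMap.ext_ring ?_)
  exact h m z

/-- For an antisymmetric 4×4 matrix P of entire functions on ℂ⁴ vanishing at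
some point z₀: P is an exact holomorphic Poisson bivector (Jacobi identity + divergence-free)
iff its Pfaffian P^{12}P^{34} − P^{13}P^{24} + P^{14}P^{23} vanishes identically and P is
divergence-free. -/
theorem exact_poisson_iff_pfaffian
    (P : (Fin 4 → ℂ) → Matrix (Fin 4) (Fin 4) ℂ)
    (hP : ∀ i j z, AnalyticAt ℂ (fun w => P w i j) z)
    (hPanti : ∀ z i j, P z i j = -P z j i)
    (z₀ : Fin 4 → ℂ) (hz₀ : P z₀ = 0) :
    ((∀ z, ∀ i j k : Fin 4,
        (∑ l, (P z l i * pd (fun w => P w j k) l z +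
               P z l j * pd (fun w => P w k i) l z +
               P z l k * pd (fun w => P w i j) l z)) = 0) ∧
     (∀ i : Fin 4, ∀ z, (∑ j, pd (fun w => P w i j) j z) = 0)) ↔
    ((∀ z, P z 0 1 * P z 2 3 - P z 0 2 * P z 1 3 + P z 0 3 * P z 1 2 = 0) ∧
     (∀ i : Fin 4, ∀ z, (∑ j, pd (fun w => P w i j) j z) = 0)) := by
  have hd (i j : Fin 4) (z : Fin 4 → ℂ) : DifferentiableAt ℂ (fun w => P w i j) z :=
    (hP i j z).differentiableAt
  refine and_congr_left fun hdivP => ?_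
  simp only [jacobiator_eq_sum_pd_wedgeSq hd hPanti hdivP]
  refine ⟨fun h z => ?_, fun h z i j k => ?_⟩
  · have hconst := eq_of_pd_eq_zero (differentiable_pfaffianFour hd)
      (pd_pfaffianFour_eq_zero hPanti h) z z₀
    simpa [pfaffianFour, hz₀] using hconst
  · have hQ (l : Fin 4) (w : Fin 4 → ℂ) : wedgeSq (P w) l i j k = 0 :=
      wedgeSq_eq_zero_of_pfaffianFour (hPanti w) (h w) l i j k
    simp [hQ, pd]
end

section
/- Let Z, Z₁, …, Z_n be holomorphic vector fields on ℂⁿ with entire components, and let f_i^k (1 ≤ i,k ≤ n) be entire functions such that the Lie brackets satisfy [Z, Z_i] = Σ_{k=1}^n f_i^k Z_k for every i, and such that the trace vanishes: Σ_{k=1}^n f_k^k = 0 identically. Define β(z) = det(Z₁(z), …, Z_n(z)), the determinant of the n×n matrix whose columns are the vectors Z_i(z) (this equals ω₀(Z₁,…,Z_n) for the standard volume form ω₀ = dz¹∧⋯∧dzⁿ). Then β is an inverse holomorphic multiplier for Z, i.e. Z(β) = (div Z)·β identically on ℂⁿ. -/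
open scoped BigOperators

variable {n : ℕ}

namespace Matrix

variable {ι R : Type*} [Fintype ι] [DecidableEq ι] [CommRing R]

/-- Replacing each column of `M` in turn by the corresponding column of `B` and summing the
determinants gives the trace of `adjugate M * B`. -/
lemma sum_det_updateCol_eq_trace_adjugate_mul (M B : Matrix ι ι R) :
    ∑ i, (M.updateCol i fun a => B a i).det = (M.adjugate * B).trace := by
  simp only [← cramer_apply, cramer_eq_adjugate_mulVec, trace, diag_apply, mul_apply, mulVec,
    dotProduct]

lemma trace_adjugate_mul_mul_add_mul (M J F : Matrix ι ι R) :
    (M.adjugate * (J * M + M * F)).trace = (J.trace + F.trace) * M.det := by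
  rw [Matrix.mul_add, trace_add, ← Matrix.mul_assoc, trace_mul_cycle, ← Matrix.mul_assoc,
    mul_adjugate, adjugate_mul]
  simp only [smul_mul, Matrix.one_mul, trace_smul, smul_eq_mul]
  ring

/-- **Jacobi's formula** for the determinant of the matrix with columns `v i x`. -/
lemma hasFDerivAt_det_of_columns {𝕜 E : Type*} [NontriviallyNormedField 𝕜]
    [NormedAddCommGroup E] [NormedSpace 𝕜 E] {v : ι → E → ι → 𝕜} {v' : ι → E →L[𝕜] ι → 𝕜}
    {x : E} (hv : ∀ i, HasFDerivAt (v i) (v' i) x) :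
    ∃ L : E →L[𝕜] 𝕜, HasFDerivAt (fun y => (of fun a b => v b y a).det) L x ∧
      ∀ h, L h = ((of fun a b => v b x a).adjugate * of fun a b => v' b h a).trace := by
  let D : ContinuousMultilinearMap 𝕜 (fun _ : ι => ι → 𝕜) 𝕜 :=
    { (detRowAlternating (R := 𝕜) (n := ι)).toMultilinearMap with
      cont := Continuous.matrix_det (A := fun M : Matrix ι ι 𝕜 => M) continuous_id }
  have hD : ∀ w : ι → ι → 𝕜, D w = (of fun a b => w b a).det := fun w =>
    (det_transpose (of w)).symm
  refine ⟨(D.linearDeriv fun i => v i x).comp (ContinuousLinearMap.pi v'), ?_, fun h => ?_⟩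
  · simpa only [Function.comp_def, hD] using
      (D.hasFDerivAt fun i => v i x).comp x (hasFDerivAt_pi.2 hv)
  · rw [← sum_det_updateCol_eq_trace_adjugate_mul, ContinuousLinearMap.comp_apply,
      ContinuousMultilinearMap.linearDeriv_apply]
    refine Finset.sum_congr rfl fun i _ => ?_
    rw [hD]
    congr 1
    ext a b
    by_cases hb : b = i
    · subst hb; simp
    · simp [hb]

end Matrix

lemma sum_mul_apply_single_one (L : (Fin n → ℂ) →L[ℂ] ℂ) (w : Fin n → ℂ) :
    ∑ k, w k * L (Pi.single k 1) = L w := by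
  conv_rhs => rw [pi_eq_sum_univ' w]
  simp [map_sum]

/-- The divergence is the trace of the Jacobian matrix. -/
lemma hdiv_eq_trace_toMatrix' {Z : (Fin n → ℂ) → (Fin n → ℂ)} {z : Fin n → ℂ}
    (hZ : DifferentiableAt ℂ Z z) :
    hdiv Z z = (LinearMap.toMatrix' (fderiv ℂ Z z : (Fin n → ℂ) →ₗ[ℂ] (Fin n → ℂ))).trace := by
  simp only [hdiv, pd, Matrix.trace, Matrix.diag_apply, LinearMap.toMatrix'_apply]
  refine Finset.sum_congr rfl fun k _ => ?_
  rw [((hasFDerivAt_pi'.1 hZ.hasFDerivAt) k).fderiv]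
  simp

/-- If [Z, Zᵢ] = Σ_k fᵢᵏ Z_k with vanishing trace Σ_k f_kᵏ = 0, then
β = det(Z₁,…,Z_n) is an inverse holomorphic multiplier for Z: Z(β) = (div Z)·β. -/
theorem inverse_multiplier_of_frame
    (Z : (Fin n → ℂ) → (Fin n → ℂ)) (hZ : ∀ z, AnalyticAt ℂ Z z)
    (Zv : Fin n → (Fin n → ℂ) → (Fin n → ℂ)) (hZv : ∀ i z, AnalyticAt ℂ (Zv i) z)
    (f : Fin n → Fin n → (Fin n → ℂ) → ℂ) (hf : ∀ i k z, AnalyticAt ℂ (f i k) z)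
    (hbr : ∀ i z, lie Z (Zv i) z = ∑ k, f i k z • Zv k z)
    (htr : ∀ z, ∑ k, f k k z = 0) :
    ∀ z, (∑ k, Z z k *
        pd (fun w => Matrix.det (Matrix.of fun a b => Zv b w a)) k z) =
      hdiv Z z * Matrix.det (Matrix.of fun a b => Zv b z a) := by
  intro z
  obtain ⟨L, hL, hL_apply⟩ := Matrix.hasFDerivAt_det_of_columns
    fun i => (hZv i z).differentiableAt.hasFDerivAt
  set M : Matrix (Fin n) (Fin n) ℂ := Matrix.of fun a b => Zv b z a with hM
  set J := LinearMap.toMatrix' (fderiv ℂ Z z : (Fin n → ℂ) →ₗ[ℂ] (Fin n → ℂ))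
  have hDeriv : (Matrix.of fun a b => fderiv ℂ (Zv b) z (Z z) a) =
      J * M + M * Matrix.of fun k i => f i k z := by
    ext a b
    have hJM : (J * M) a b = fderiv ℂ Z z (Zv b z) a :=
      congrFun (LinearMap.toMatrix'_mulVec
        (fderiv ℂ Z z : (Fin n → ℂ) →ₗ[ℂ] (Fin n → ℂ)) (Zv b z)) a
    have hlie := congrFun (hbr b z) a
    simp only [lie, Pi.sub_apply, Finset.sum_apply, Pi.smul_apply, smul_eq_mul] at hlie
    rw [Matrix.add_apply, hJM, Matrix.of_apply, eq_add_of_sub_eq' hlie, Matrix.mul_apply]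
    simp only [hM, Matrix.of_apply, mul_comm]
  have htrace : (Matrix.of fun k i => f i k z).trace = 0 := htr z
  simp only [pd, hL.fderiv]
  rw [sum_mul_apply_single_one, hL_apply, hDeriv, Matrix.trace_adjugate_mul_mul_add_mul, htrace,
    add_zero, hdiv_eq_trace_toMatrix' (hZ z).differentiableAt]
end

section
/- Let Z₁, …, Z_n be holomorphic vector fields on ℂⁿ with entire components, and let f_{ij}^k be entire functions with [Z_i, Z_j] = Σ_{k=1}^n f_{ij}^k Z_k for all i,j. Suppose g₁, …, g_n are entire functions satisfying Σ_{k=1}^n ( Σ_{i=1}^n g_i f_{ik}^k − Z_k(g_k) ) = 0 identically. Then β(z) = det(Z₁(z), …, Z_n(z)) is an inverse holomorphic multiplier for the holomorphic vector field Z = Σ_{k=1}^n g_k Z_k, i.e. Z(β) = (div Z)·β identically on ℂⁿ. -/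
open scoped BigOperators

variable {n : ℕ}

/-- The derivative of a determinant, differentiated column by column. -/
theorem fderiv_det_columns (Zv : Fin n → (Fin n → ℂ) → (Fin n → ℂ)) (z : Fin n → ℂ)
    (hZv : ∀ i, DifferentiableAt ℂ (Zv i) z) (v : Fin n → ℂ) :
    fderiv ℂ (fun w => Matrix.det (Matrix.of fun c b => Zv b w c)) z v =
      ∑ k, Matrix.cramer (Matrix.of fun c b => Zv b z c) (fderiv ℂ (Zv k) z v) k := by
  let D : ContinuousMultilinearMap ℂ (fun _ : Fin n => Fin n → ℂ) ℂ :=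
    { toMultilinearMap :=
        (Matrix.detRowAlternating (n := Fin n) (R := ℂ)).toMultilinearMap
      cont := Continuous.matrix_det (A := fun M : Matrix (Fin n) (Fin n) ℂ => M) continuous_id }
  have hD : (fun w => Matrix.det (Matrix.of fun c b => Zv b w c)) =
      fun w => D (fun b => Zv b w) := by
    funext w
    exact Matrix.det_transpose (Matrix.of fun b c => Zv b w c)
  rw [hD, (HasFDerivAt.multilinear_comp D fun i => (hZv i).hasFDerivAt).fderiv, sum_apply]
  refine Finset.sum_congr rfl fun k _ => ?_
  exact (Matrix.cramer_transpose_apply (Matrix.of fun b c => Zv b z c) _ k).symm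

/-- Replacing each column of `M` in turn by its image under `L` and adding up the determinants
multiplies `det M` by the trace of `L`. -/
theorem sum_cramer_map_columns (M : Matrix (Fin n) (Fin n) ℂ)
    (L : (Fin n → ℂ) →ₗ[ℂ] (Fin n → ℂ)) :
    ∑ k, M.cramer (L (M.col k)) k = LinearMap.trace ℂ _ L * M.det := by
  have h : ∀ k, M.cramer (L (M.col k)) k = (M.adjugate * (L.toMatrix' * M)) k k := by
    intro k
    rw [Matrix.cramer_eq_adjugate_mulVec, ← LinearMap.toMatrix'_mulVec L]
    rfl
  calc ∑ k, M.cramer (L (M.col k)) k = Matrix.trace (M.adjugate * (L.toMatrix' * M)) :=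
        Finset.sum_congr rfl fun k _ => h k
    _ = LinearMap.trace ℂ _ L * M.det := by
        rw [Matrix.trace_mul_comm, Matrix.mul_assoc, Matrix.mul_adjugate, Matrix.mul_smul,
          Matrix.mul_one, Matrix.trace_smul, smul_eq_mul, mul_comm,
          LinearMap.trace_eq_matrix_trace ℂ (Pi.basisFun ℂ (Fin n)),
          LinearMap.toMatrix_eq_toMatrix']

/-- A directional derivative in terms of partial derivatives. -/
theorem sum_mul_pd (h : (Fin n → ℂ) → ℂ) (z v : Fin n → ℂ) :
    ∑ a, v a * pd h a z = fderiv ℂ h z v := by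
  conv_rhs => rw [pi_eq_sum_univ' v, map_sum]
  simp only [pd, map_smul, smul_eq_mul]

/-- The divergence is the trace of the derivative. -/
theorem hdiv_eq_trace (Z : (Fin n → ℂ) → (Fin n → ℂ)) (z : Fin n → ℂ)
    (hZ : DifferentiableAt ℂ Z z) :
    hdiv Z z = LinearMap.trace ℂ _ (fderiv ℂ Z z).toLinearMap := by
  rw [LinearMap.trace_eq_matrix_trace ℂ (Pi.basisFun ℂ (Fin n)), LinearMap.toMatrix_eq_toMatrix']
  refine Finset.sum_congr rfl fun k _ => ?_
  rw [pd, fderiv_apply hZ]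
  simp [LinearMap.toMatrix'_apply]

/-- The divergence of a linear combination of vector fields with function coefficients. -/
theorem hdiv_sum_mul (Zv : Fin n → (Fin n → ℂ) → (Fin n → ℂ)) (g : Fin n → (Fin n → ℂ) → ℂ)
    (z : Fin n → ℂ) (hZv : ∀ i, DifferentiableAt ℂ (Zv i) z)
    (hg : ∀ i, DifferentiableAt ℂ (g i) z) :
    hdiv (fun w a => ∑ k, g k w * Zv k w a) z =
      ∑ k, (g k z * hdiv (Zv k) z + ∑ j, Zv k z j * pd (g k) j z) := by
  simp only [hdiv, pd, Finset.mul_sum, ← Finset.sum_add_distrib]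
  rw [Finset.sum_comm]
  refine Finset.sum_congr rfl fun a _ => ?_
  have hc : ∀ k, DifferentiableAt ℂ (fun w => Zv k w a) z :=
    fun k => differentiableAt_pi.1 (hZv k) a
  rw [fderiv_fun_sum fun k _ => (hg k).fun_mul (hc k), sum_apply]
  refine Finset.sum_congr rfl fun k _ => ?_
  rw [fderiv_fun_mul (hg k) (hc k)]
  simp

/-- In an involutive frame, each frame field rescales the determinant of the frame by its
divergence plus the trace of its structure functions. -/
theorem fderiv_det_frame (Zv : Fin n → (Fin n → ℂ) → (Fin n → ℂ)) (z : Fin n → ℂ)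
    (hZv : ∀ i, DifferentiableAt ℂ (Zv i) z) (i : Fin n) (f : Fin n → Fin n → ℂ)
    (hbr : ∀ j, lie (Zv i) (Zv j) z = ∑ k, f j k • Zv k z) :
    fderiv ℂ (fun w => Matrix.det (Matrix.of fun c b => Zv b w c)) z (Zv i z) =
      (∑ k, f k k + hdiv (Zv i) z) * Matrix.det (Matrix.of fun c b => Zv b z c) := by
  set M : Matrix (Fin n) (Fin n) ℂ := Matrix.of fun c b => Zv b z c
  have hcol : ∀ l, M.cramer (Zv l z) = Pi.single l M.det :=
    fun l => Matrix.cramer_row_self M _ l fun _ => rfl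
  have hk : ∀ k, M.cramer (fderiv ℂ (Zv k) z (Zv i z)) k =
      f k k * M.det + M.cramer ((fderiv ℂ (Zv i) z).toLinearMap (M.col k)) k := by
    intro k
    have hb : fderiv ℂ (Zv k) z (Zv i z) =
        (∑ l, f k l • Zv l z) + (fderiv ℂ (Zv i) z).toLinearMap (M.col k) :=
      sub_eq_iff_eq_add.1 (hbr k)
    rw [hb, map_add, map_sum, Pi.add_apply, Finset.sum_apply]
    simp [hcol, Pi.single_apply]
  rw [fderiv_det_columns Zv z hZv, Finset.sum_congr rfl fun k _ => hk k, Finset.sum_add_distrib,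
    sum_cramer_map_columns, hdiv_eq_trace _ z (hZv i), ← Finset.sum_mul, add_mul]

/-- If [Zᵢ, Z_j] = Σ_k f_{ij}ᵏ Z_k and the entire functions g_k satisfy
Σ_k (Σ_i g_i f_{ik}ᵏ − Z_k(g_k)) = 0, then β = det(Z₁,…,Z_n) is an inverse holomorphic
multiplier for Z = Σ_k g_k Z_k. -/
theorem inverse_multiplier_of_structure_functions
    (Zv : Fin n → (Fin n → ℂ) → (Fin n → ℂ)) (hZv : ∀ i z, AnalyticAt ℂ (Zv i) z)
    (f : Fin n → Fin n → Fin n → (Fin n → ℂ) → ℂ)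
    (hf : ∀ i j k z, AnalyticAt ℂ (f i j k) z)
    (hbr : ∀ i j z, lie (Zv i) (Zv j) z = ∑ k, f i j k z • Zv k z)
    (g : Fin n → (Fin n → ℂ) → ℂ) (hg : ∀ k z, AnalyticAt ℂ (g k) z)
    (hcond : ∀ z, ∑ k, ((∑ i, g i z * f i k k z) - ∑ j, Zv k z j * pd (g k) j z) = 0) :
    ∀ z, (∑ a, (∑ k, g k z * Zv k z a) *
        pd (fun w => Matrix.det (Matrix.of fun c b => Zv b w c)) a z) =
      hdiv (fun w a => ∑ k, g k w * Zv k w a) z *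
        Matrix.det (Matrix.of fun c b => Zv b z c) := by
  intro z
  have hZ : ∀ i, DifferentiableAt ℂ (Zv i) z := fun i => (hZv i z).differentiableAt
  have hG : ∀ i, DifferentiableAt ℂ (g i) z := fun i => (hg i z).differentiableAt
  have hv : ∀ a, ∑ k, g k z * Zv k z a = (∑ k, g k z • Zv k z) a := by simp
  have hc := hcond z
  rw [Finset.sum_sub_distrib, Finset.sum_comm, sub_eq_zero] at hc
  simp only [← Finset.mul_sum] at hc
  rw [Finset.sum_congr rfl fun a _ => by rw [hv a], sum_mul_pd, map_sum,
    hdiv_sum_mul Zv g z hZ hG, Finset.sum_add_distrib, ← hc, ← Finset.sum_add_distrib,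
    Finset.sum_mul]
  refine Finset.sum_congr rfl fun i _ => ?_
  rw [map_smul, fderiv_det_frame Zv z hZ i (fun j k => f i j k z) fun j => hbr i j z, smul_eq_mul]
  ring
end

section
/- Let Z be a holomorphic vector field on ℂⁿ with entire components and let S₁, …, S_{n−1} be holomorphic vector fields which are symmetries of Z, i.e. there exist entire functions λ₁, …, λ_{n−1} with [Z, S_i] = λ_i·Z for each i. Then β(z) = det(Z(z), S₁(z), …, S_{n−1}(z)) (the determinant of the matrix whose columns are Z, S₁, …, S_{n−1}, equal to (ι_{S_{n−1}}⋯ι_{S₁}ι_Z ω₀) up to sign) is an inverse holomorphic multiplier for Z, i.e. Z(β) = (div Z)·β identically on ℂⁿ. -/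
open scoped BigOperators

variable {n : ℕ}

open scoped Matrix

/-- Applying an endomorphism to one row of a matrix at a time and summing the determinants
multiplies the determinant by the trace. -/
theorem Matrix.sum_det_updateRow_mulVec {ι R : Type*} [Fintype ι] [DecidableEq ι] [CommRing R]
    (M A : Matrix ι ι R) :
    ∑ i, (M.updateRow i (A *ᵥ M i)).det = A.trace * M.det := by
  calc ∑ i, (M.updateRow i (A *ᵥ M i)).det
      = (Mᵀ.adjugate * (A * Mᵀ)).trace := by
        refine Finset.sum_congr rfl fun i _ => ?_
        rw [← Matrix.cramer_transpose_apply, Matrix.cramer_eq_adjugate_mulVec]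
        rfl
    _ = A.trace * M.det := by
        rw [Matrix.trace_mul_comm, Matrix.mul_assoc, Matrix.mul_adjugate, Matrix.det_transpose]
        simp [mul_comm]

/-- Jacobi's formula in row form. -/
theorem fderiv_det_rows {ι 𝕜 E : Type*} [Fintype ι] [DecidableEq ι]
    [NontriviallyNormedField 𝕜] [NormedAddCommGroup E] [NormedSpace 𝕜 E]
    {F : ι → E → ι → 𝕜} {F' : ι → E →L[𝕜] (ι → 𝕜)} {z : E}
    (hF : ∀ i, HasFDerivAt (F i) (F' i) z) (v : E) :
    fderiv 𝕜 (fun w => (Matrix.of fun i => F i w).det) z v =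
      ∑ i, ((Matrix.of fun i => F i z).updateRow i (F' i v)).det := by
  let D : ContinuousMultilinearMap 𝕜 (fun _ : ι => ι → 𝕜) 𝕜 :=
    { (Matrix.detRowAlternating (R := 𝕜) (n := ι)).toMultilinearMap with
      cont := Continuous.matrix_det (A := fun M : ι → ι → 𝕜 => Matrix.of M) continuous_id }
  refine (congrArg (fun L : E →L[𝕜] 𝕜 => L v)
    (HasFDerivAt.multilinear_comp D hF).fderiv).trans ?_
  simp only [sum_apply]
  rfl

/-- If S₁,…,S_{n−1} are symmetries of Z ([Z,Sᵢ] = λᵢ Z), then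
β = det(Z, S₁, …, S_{n−1}) is an inverse holomorphic multiplier for Z.
(Here the ambient space is ℂ^{n+1} with n symmetries.) -/
theorem inverse_multiplier_of_symmetries
    (Z : (Fin (n + 1) → ℂ) → (Fin (n + 1) → ℂ)) (hZ : ∀ z, AnalyticAt ℂ Z z)
    (S : Fin n → (Fin (n + 1) → ℂ) → (Fin (n + 1) → ℂ))
    (hS : ∀ i z, AnalyticAt ℂ (S i) z)
    (lam : Fin n → (Fin (n + 1) → ℂ) → ℂ) (hlam : ∀ i z, AnalyticAt ℂ (lam i) z)
    (hsym : ∀ i z, lie Z (S i) z = lam i z • Z z) :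
    ∀ z, (∑ k, Z z k *
        pd (fun w => Matrix.det
          (Matrix.of fun a b =>
            (Fin.cons (Z w) (fun i => S i w) : Fin (n + 1) → Fin (n + 1) → ℂ) b a)) k z) =
      hdiv Z z *
        Matrix.det (Matrix.of fun a b =>
          (Fin.cons (Z z) (fun i => S i z) : Fin (n + 1) → Fin (n + 1) → ℂ) b a) := by
  intro z
  set F : Fin (n + 1) → (Fin (n + 1) → ℂ) → (Fin (n + 1) → ℂ) := Fin.cons Z S with hFdef
  have hcons : ∀ w, (Fin.cons (Z w) (fun i => S i w) : Fin (n + 1) → Fin (n + 1) → ℂ) =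
      fun i => F i w := by
    intro w
    funext i
    refine Fin.cases ?_ (fun j => ?_) i <;> simp [hFdef]
  have hdet : ∀ w, Matrix.det (Matrix.of fun a b =>
      (Fin.cons (Z w) (fun i => S i w) : Fin (n + 1) → Fin (n + 1) → ℂ) b a) =
      (Matrix.of fun i => F i w).det := by
    intro w
    rw [hcons, ← Matrix.det_transpose]
    rfl
  simp only [hdet]
  have hF : ∀ i, HasFDerivAt (F i) (fderiv ℂ (F i) z) z := by
    refine Fin.cases ?_ fun j => ?_
    · exact (hZ z).differentiableAt.hasFDerivAt
    · exact (hS j z).differentiableAt.hasFDerivAt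
  have hdir : ∀ f : (Fin (n + 1) → ℂ) → ℂ, ∑ k, Z z k * pd f k z = fderiv ℂ f z (Z z) := by
    intro f
    conv_rhs => rw [pi_eq_sum_univ' (Z z)]
    simp [pd]
  rw [hdir, fderiv_det_rows hF]
  set A : Matrix (Fin (n + 1)) (Fin (n + 1)) ℂ :=
    LinearMap.toMatrix' (fderiv ℂ Z z : (Fin (n + 1) → ℂ) →ₗ[ℂ] (Fin (n + 1) → ℂ)) with hA
  have hAv : ∀ v, A.mulVec v = fderiv ℂ Z z v := fun v => by
    rw [hA, LinearMap.toMatrix'_mulVec]; rfl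
  have htr : hdiv Z z = A.trace := by
    refine Finset.sum_congr rfl fun k _ => ?_
    have := (hasFDerivAt_pi'.1 (hZ z).differentiableAt.hasFDerivAt k).fderiv
    simp [pd, this, hA, LinearMap.toMatrix'_apply]
  rw [htr, ← Matrix.sum_det_updateRow_mulVec]
  refine Finset.sum_congr rfl fun i _ => ?_
  rw [hAv]
  refine Fin.cases rfl (fun j => ?_) i
  have hj : fderiv ℂ (F j.succ) z (Z z) = fderiv ℂ Z z (F j.succ z) + lam j z • Z z :=
    sub_eq_iff_eq_add'.1 (hsym j z)
  rw [hj, Matrix.det_updateRow_add, Matrix.det_updateRow_smul]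
  have h0 : ((Matrix.of fun i => F i z).updateRow j.succ (Z z)).det = 0 := by
    refine Matrix.det_zero_of_row_eq (Fin.succ_ne_zero j).symm ?_
    rw [Matrix.updateRow_self, Matrix.updateRow_ne (Fin.succ_ne_zero j).symm]
    rfl
  rw [h0, mul_zero, add_zero]
  rfl
end

section
/- Let α be an entire function on ℂⁿ and let Z, W be holomorphic vector fields on ℂⁿ with entire components such that α is a holomorphic last multiplier for both Z and W, i.e. Z(α) + α·div Z = 0 and W(α) + α·div W = 0 identically. Then α is also a holomorphic last multiplier for the Lie bracket [Z,W], i.e. [Z,W](α) + α·div([Z,W]) = 0 identically. (Hence the set of holomorphic vector fields admitting α as a last multiplier is a Lie subalgebra.) -/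
open scoped BigOperators

variable {n : ℕ}

/-- Derivative of a function along a vector field, in coordinates. -/
theorem sum_mul_pd_eq_fderiv (f : (Fin n → ℂ) → ℂ) (v z : Fin n → ℂ) :
    ∑ k, v k * pd f k z = fderiv ℂ f z v := by
  conv_rhs => rw [pi_eq_sum_univ' v]
  simp [pd, map_sum]

/-- The holomorphic divergence is the sum of the diagonal entries of the Fréchet derivative. -/
theorem hdiv_eq_sum_fderiv {Z : (Fin n → ℂ) → (Fin n → ℂ)} {z : Fin n → ℂ}
    (hZ : DifferentiableAt ℂ Z z) :
    hdiv Z z = ∑ k, fderiv ℂ Z z (Pi.single k 1) k := by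
  simp only [hdiv, pd]
  refine Finset.sum_congr rfl fun k _ => ?_
  rw [fderiv_apply hZ k]
  rfl

/-- The diagonal sum of a composition of endomorphisms of ℂⁿ does not depend on the order. -/
theorem sum_diag_comp_comm (A B : (Fin n → ℂ) →L[ℂ] (Fin n → ℂ)) :
    ∑ k, A (B (Pi.single k 1)) k = ∑ k, B (A (Pi.single k 1)) k := by
  have h := LinearMap.trace_mul_comm ℂ (A : (Fin n → ℂ) →ₗ[ℂ] (Fin n → ℂ)) B
  simpa [LinearMap.trace_eq_matrix_trace ℂ (Pi.basisFun ℂ (Fin n)), Matrix.trace,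
    LinearMap.toMatrix_apply] using h

/-- Product rule for `z ↦ Df(z)(V(z))`. -/
theorem fderiv_fderiv_apply {F : Type*} [NormedAddCommGroup F] [NormedSpace ℂ F]
    [CompleteSpace F] {f : (Fin n → ℂ) → F} {V : (Fin n → ℂ) → (Fin n → ℂ)} {z : Fin n → ℂ}
    (hf : AnalyticAt ℂ f z) (hV : DifferentiableAt ℂ V z) (v : Fin n → ℂ) :
    fderiv ℂ (fun w => fderiv ℂ f w (V w)) z v
      = fderiv ℂ (fderiv ℂ f) z v (V z) + fderiv ℂ f z (fderiv ℂ V z v) := by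
  rw [fderiv_clm_apply hf.fderiv.differentiableAt hV]
  simp [add_comm]

/-- The second derivative of a holomorphic function is symmetric. -/
theorem AnalyticAt.fderiv_fderiv_comm {F : Type*} [NormedAddCommGroup F] [NormedSpace ℂ F]
    [CompleteSpace F] {f : (Fin n → ℂ) → F} {z : Fin n → ℂ} (hf : AnalyticAt ℂ f z)
    (v w : Fin n → ℂ) :
    fderiv ℂ (fderiv ℂ f) z v w = fderiv ℂ (fderiv ℂ f) z w v :=
  hf.contDiffAt.isSymmSndFDerivAt_of_omega v w

/-- The divergence is differentiable, and its derivative is the diagonal sum of the second derivative. -/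
theorem differentiableAt_hdiv_and_fderiv {Z : (Fin n → ℂ) → (Fin n → ℂ)}
    (hZ : ∀ z, AnalyticAt ℂ Z z)
    (z : Fin n → ℂ) :
    DifferentiableAt ℂ (hdiv Z) z ∧ ∀ v, fderiv ℂ (hdiv Z) z v
      = ∑ k, fderiv ℂ (fderiv ℂ Z) z v (Pi.single k 1) k := by
  have hfun : hdiv Z = fun w => ∑ k, fderiv ℂ Z w (Pi.single k 1) k :=
    funext fun w => hdiv_eq_sum_fderiv (hZ w).differentiableAt
  have hd (k : Fin n) : DifferentiableAt ℂ (fun w => fderiv ℂ Z w (Pi.single k 1)) z :=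
    (hZ z).fderiv.differentiableAt.clm_apply (differentiableAt_const _)
  have hdk (k : Fin n) : DifferentiableAt ℂ (fun w => fderiv ℂ Z w (Pi.single k 1) k) z :=
    differentiableAt_pi.1 (hd k) k
  rw [hfun]
  refine ⟨DifferentiableAt.fun_sum fun k _ => hdk k, fun v => ?_⟩
  rw [fderiv_fun_sum fun k _ => hdk k, sum_apply]
  refine Finset.sum_congr rfl fun k _ => ?_
  rw [fderiv_apply (hd k) k]
  simp [fderiv_fderiv_apply (hZ z) (differentiableAt_const _)]

/-- div [Z, W] = Z(div W) - W(div Z). -/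
theorem hdiv_lie {Z W : (Fin n → ℂ) → (Fin n → ℂ)} (hZ : ∀ z, AnalyticAt ℂ Z z)
    (hW : ∀ z, AnalyticAt ℂ W z) (z : Fin n → ℂ) :
    hdiv (lie Z W) z = fderiv ℂ (hdiv W) z (Z z) - fderiv ℂ (hdiv Z) z (W z) := by
  have hWZ : DifferentiableAt ℂ (fun w => fderiv ℂ W w (Z w)) z :=
    (hW z).fderiv.differentiableAt.clm_apply (hZ z).differentiableAt
  have hZW : DifferentiableAt ℂ (fun w => fderiv ℂ Z w (W w)) z :=
    (hZ z).fderiv.differentiableAt.clm_apply (hW z).differentiableAt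
  have hlie : lie Z W = fun w => fderiv ℂ W w (Z w) - fderiv ℂ Z w (W w) := rfl
  rw [hlie, hdiv_eq_sum_fderiv (hWZ.fun_sub hZW), fderiv_fun_sub hWZ hZW,
    (differentiableAt_hdiv_and_fderiv hW z).2,
    (differentiableAt_hdiv_and_fderiv hZ z).2]
  simp only [sub_apply, Pi.sub_apply, Pi.add_apply, Finset.sum_sub_distrib,
    Finset.sum_add_distrib, fderiv_fderiv_apply (hW z) (hZ z).differentiableAt,
    fderiv_fderiv_apply (hZ z) (hW z).differentiableAt]
  rw [sum_diag_comp_comm (fderiv ℂ W z)]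
  simp only [(hW z).fderiv_fderiv_comm _ (Z z), (hZ z).fderiv_fderiv_comm _ (W z)]
  ring

/-- [Z, W](f) = Z(W(f)) - W(Z(f)). -/
theorem fderiv_apply_lie {f : (Fin n → ℂ) → ℂ} {Z W : (Fin n → ℂ) → (Fin n → ℂ)}
    {z : Fin n → ℂ} (hf : AnalyticAt ℂ f z) (hZ : DifferentiableAt ℂ Z z)
    (hW : DifferentiableAt ℂ W z) :
    fderiv ℂ f z (lie Z W z) = fderiv ℂ (fun w => fderiv ℂ f w (W w)) z (Z z)
      - fderiv ℂ (fun w => fderiv ℂ f w (Z w)) z (W z) := by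
  rw [fderiv_fderiv_apply hf hW, fderiv_fderiv_apply hf hZ, hf.fderiv_fderiv_comm (W z), lie,
    map_sub]
  ring

/-- Derivative of `Z(α) = -α · div Z` for a last multiplier α. -/
theorem IsHLM.fderiv_fderiv_apply {α : (Fin n → ℂ) → ℂ} {Z : (Fin n → ℂ) → (Fin n → ℂ)}
    (h : IsHLM Z α) (hZ : ∀ z, AnalyticAt ℂ Z z) {z : Fin n → ℂ} (hα : DifferentiableAt ℂ α z)
    (v : Fin n → ℂ) :
    fderiv ℂ (fun w => fderiv ℂ α w (Z w)) z v
      = -(α z * fderiv ℂ (hdiv Z) z v + hdiv Z z * fderiv ℂ α z v) := by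
  have hfun : (fun w => fderiv ℂ α w (Z w)) = fun w => -(α w * hdiv Z w) :=
    funext fun w => eq_neg_of_add_eq_zero_left (sum_mul_pd_eq_fderiv α (Z w) w ▸ h w)
  rw [hfun, fderiv_fun_neg, fderiv_fun_mul hα (differentiableAt_hdiv_and_fderiv hZ z).1]
  simp

/-- If α is a holomorphic last multiplier for both Z and W, then α is a
holomorphic last multiplier for the Lie bracket [Z,W]. -/
theorem last_multiplier_lie_bracket
    (α : (Fin n → ℂ) → ℂ) (hα : ∀ z, AnalyticAt ℂ α z)
    (Z W : (Fin n → ℂ) → (Fin n → ℂ))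
    (hZ : ∀ z, AnalyticAt ℂ Z z) (hW : ∀ z, AnalyticAt ℂ W z)
    (hZm : IsHLM Z α) (hWm : IsHLM W α) :
    IsHLM (lie Z W) α := by
  intro z
  have hZz := hZm z
  have hWz := hWm z
  have hd := (hα z).differentiableAt
  rw [sum_mul_pd_eq_fderiv] at hZz hWz ⊢
  rw [fderiv_apply_lie (hα z) (hZ z).differentiableAt (hW z).differentiableAt, hdiv_lie hZ hW,
    hWm.fderiv_fderiv_apply hW hd, hZm.fderiv_fderiv_apply hZ hd]
  linear_combination hdiv Z z * hWz - hdiv W z * hZz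
end

section
/- Let f and α be entire functions on ℂⁿ (equipped with the holomorphic euclidean metric) such that f is a holomorphic last multiplier for grad α and α is a holomorphic last multiplier for grad f; explicitly, Σ_i (∂α/∂z^i)(∂f/∂z^i) + f·Δα = 0 and Σ_i (∂f/∂z^i)(∂α/∂z^i) + α·Δf = 0 identically, where Δu = Σ_i ∂²u/∂(z^i)². Then the product f·α is a holomorphic harmonic function: Δ(f·α) = 0 identically on ℂⁿ. -/
open scoped BigOperators

variable {n : ℕ}

theorem pd_mul {f g : (Fin n → ℂ) → ℂ} {z : Fin n → ℂ} (hf : DifferentiableAt ℂ f z)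
    (hg : DifferentiableAt ℂ g z) (i : Fin n) :
    pd (fun w => f w * g w) i z = f z * pd g i z + g z * pd f i z := by
  simp [pd, fderiv_fun_mul hf hg]

theorem pd_add {f g : (Fin n → ℂ) → ℂ} {z : Fin n → ℂ} (hf : DifferentiableAt ℂ f z)
    (hg : DifferentiableAt ℂ g z) (i : Fin n) :
    pd (fun w => f w + g w) i z = pd f i z + pd g i z := by
  simp [pd, fderiv_fun_add hf hg]

theorem AnalyticAt.differentiableAt_pd {f : (Fin n → ℂ) → ℂ} {z : Fin n → ℂ}
    (hf : AnalyticAt ℂ f z) (i : Fin n) : DifferentiableAt ℂ (pd f i) z :=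
  hf.fderiv.differentiableAt.clm_apply (differentiableAt_const _)

/-- Leibniz rule for the holomorphic Laplacian. -/
theorem lap_mul {f g : (Fin n → ℂ) → ℂ} (hf : ∀ z, AnalyticAt ℂ f z)
    (hg : ∀ z, AnalyticAt ℂ g z) (z : Fin n → ℂ) :
    lap (fun w => f w * g w) z =
      f z * lap g z + g z * lap f z + 2 * ∑ i, pd f i z * pd g i z := by
  have hdf (w) : DifferentiableAt ℂ f w := (hf w).differentiableAt
  have hdg (w) : DifferentiableAt ℂ g w := (hg w).differentiableAt
  simp only [lap, Finset.mul_sum, ← Finset.sum_add_distrib]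
  refine Finset.sum_congr rfl fun i _ => ?_
  have hpf := (hf z).differentiableAt_pd i
  have hpg := (hg z).differentiableAt_pd i
  have hpd : pd (fun w => f w * g w) i = fun w => f w * pd g i w + g w * pd f i w :=
    funext fun w => pd_mul (hdf w) (hdg w) i
  rw [hpd, pd_add ((hdf z).fun_mul hpg) ((hdg z).fun_mul hpf), pd_mul (hdf z) hpg,
    pd_mul (hdg z) hpf]
  ring

/-- If f is a holomorphic last multiplier for grad α and α is a holomorphic
last multiplier for grad f, then fα is holomorphic harmonic: Δ(fα) = 0. -/
theorem harmonic_of_mutual_last_multipliers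
    (f α : (Fin n → ℂ) → ℂ)
    (hf : ∀ z, AnalyticAt ℂ f z) (hα : ∀ z, AnalyticAt ℂ α z)
    (h1 : ∀ z, (∑ i, pd α i z * pd f i z) + f z * lap α z = 0)
    (h2 : ∀ z, (∑ i, pd f i z * pd α i z) + α z * lap f z = 0) :
    ∀ z, lap (fun w => f w * α w) z = 0 := by
  intro z
  have h1z := h1 z
  simp only [mul_comm (pd α _ z)] at h1z
  rw [lap_mul hf hα]
  linear_combination h1z + h2 z
end

section
/- Let P = (P^{ij}) be an antisymmetric n×n matrix of entire functions on ℂⁿ and let f be a nowhere-vanishing entire function. Then f is a holomorphic last multiplier for its own holomorphic Hamiltonian vector field Z_f (i.e. Z_f(f) + f·div Z_f = 0 identically) if and only if f is a holomorphic first integral of the modular vector field, i.e. Σ_{i=1}^n P^i (∂f/∂z^i) = 0 identically, where P^i = Σ_j ∂P^{ij}/∂z^j. -/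
open scoped BigOperators

variable {n : ℕ}

/-- The contraction of an antisymmetric array with a symmetric one vanishes. -/
theorem sum_antisymm_mul_symm_eq_zero {ι : Type*} [Fintype ι] {A S : ι → ι → ℂ}
    (hA : ∀ i j, A i j = -A j i) (hS : ∀ i j, S i j = S j i) :
    ∑ j, ∑ i, A i j * S i j = 0 := by
  have h : ∑ j, ∑ i, A i j * S i j = -∑ j, ∑ i, A i j * S i j := by
    conv_lhs => rw [Finset.sum_comm]
    simp only [← Finset.sum_neg_distrib]
    refine Finset.sum_congr rfl fun i _ => Finset.sum_congr rfl fun j _ => ?_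
    rw [hA i j, hS i j, neg_mul]
  exact self_eq_neg.mp h

theorem AnalyticAt.pd {f : (Fin n → ℂ) → ℂ} {z : Fin n → ℂ} (hf : AnalyticAt ℂ f z)
    (i : Fin n) : AnalyticAt ℂ (pd f i) z :=
  ((ContinuousLinearMap.apply ℂ ℂ (Pi.single i 1 : Fin n → ℂ)).analyticAt _).comp hf.fderiv

theorem pd_sum_mul {ι : Type*} [Fintype ι] {g h : ι → (Fin n → ℂ) → ℂ} {z : Fin n → ℂ}
    (hg : ∀ i, DifferentiableAt ℂ (g i) z) (hh : ∀ i, DifferentiableAt ℂ (h i) z) (k : Fin n) :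
    pd (fun w => ∑ i, g i w * h i w) k z = ∑ i, (pd (g i) k z * h i z + g i z * pd (h i) k z) := by
  unfold pd
  rw [fderiv_fun_sum fun i _ => (hg i).fun_mul (hh i), sum_apply]
  refine Finset.sum_congr rfl fun i _ => ?_
  rw [fderiv_fun_mul (hg i) (hh i)]
  simp only [add_apply, smul_apply, smul_eq_mul]
  ring

/-- Mixed partial derivatives of a holomorphic function commute. -/
theorem pd_pd_comm {f : (Fin n → ℂ) → ℂ} {z : Fin n → ℂ} (hf : AnalyticAt ℂ f z)
    (i j : Fin n) : pd (pd f i) j z = pd (pd f j) i z := by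
  have hd : DifferentiableAt ℂ (fderiv ℂ f) z := hf.fderiv.differentiableAt
  have key (a b : Fin n) : pd (pd f a) b z =
      fderiv ℂ (fderiv ℂ f) z (Pi.single b 1) (Pi.single a 1) := by
    change fderiv ℂ (fun w => fderiv ℂ f w (Pi.single a 1)) z (Pi.single b 1) = _
    rw [fderiv_clm_apply hd (differentiableAt_const _)]
    simp
  have hsymm : IsSymmSndFDerivAt ℂ f z := hf.contDiffAt.isSymmSndFDerivAt_of_omega
  rw [key, key, hsymm.eq]

/-- The divergence of the Hamiltonian vector field of `f` is the derivative of `f` along the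
modular vector field. -/
theorem hdiv_hamiltonian {P : (Fin n → ℂ) → Matrix (Fin n) (Fin n) ℂ}
    {f : (Fin n → ℂ) → ℂ} {z : Fin n → ℂ}
    (hP : ∀ i j, AnalyticAt ℂ (fun w => P w i j) z)
    (hPanti : ∀ i j, P z i j = -P z j i) (hf : AnalyticAt ℂ f z) :
    hdiv (fun w j => ∑ i, P w i j * pd f i w) z =
      ∑ i, (∑ j, pd (fun w => P w i j) j z) * pd f i z := by
  unfold hdiv
  have h (k : Fin n) := pd_sum_mul (fun i => (hP i k).differentiableAt)
    (fun i => (hf.pd i).differentiableAt) k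
  simp only [h, Finset.sum_add_distrib]
  rw [sum_antisymm_mul_symm_eq_zero hPanti (S := fun i j => pd (pd f i) j z) (pd_pd_comm hf),
    add_zero, Finset.sum_comm]
  simp only [Finset.sum_mul]

/-- A nowhere-vanishing entire f is a holomorphic last multiplier for its
own Hamiltonian vector field Z_f iff f is a first integral of the modular vector field:
Σ_i P^i ∂f/∂z^i = 0, where P^i = Σ_j ∂P^{ij}/∂z^j. -/
theorem self_last_multiplier_hamiltonian_iff_modular_first_integral
    (P : (Fin n → ℂ) → Matrix (Fin n) (Fin n) ℂ)
    (hP : ∀ i j z, AnalyticAt ℂ (fun w => P w i j) z)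
    (hPanti : ∀ z i j, P z i j = -P z j i)
    (f : (Fin n → ℂ) → ℂ) (hf : ∀ z, AnalyticAt ℂ f z) (hf0 : ∀ z, f z ≠ 0) :
    IsHLM (fun w j => ∑ i, P w i j * pd f i w) f ↔
      ∀ z, (∑ i, (∑ j, pd (fun w => P w i j) j z) * pd f i z) = 0 := by
  refine forall_congr' fun z => ?_
  have hself : ∑ k, (∑ i, P z i k * pd f i z) * pd f k z = 0 := by
    simpa only [Finset.sum_mul, mul_assoc] using
      sum_antisymm_mul_symm_eq_zero (hPanti z) (S := fun i j => pd f i z * pd f j z)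
        fun i j => mul_comm _ _
  rw [hself, zero_add, hdiv_hamiltonian (fun i j => hP i j z) (hPanti z) (hf z),
    mul_eq_zero, or_iff_right (hf0 z)]
end
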